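/- Let L be a Submodule of (Fin n → ℂ) with finrank ℂ L = k. Then L is fixed by the torus action, i.e. t • L = L for every t : Fin n → ℂˣ, if and only if L is a coordinate subspace: there exists a subset I of Fin n with #I = k such that L is the span of the standard basis vectors {e_i : i ∈ I}. Consequently, the fixed points of the (ℂˣ)ⁿ-action on the set of k-dimensional subspaces of ℂⁿ are in bijection with the k-element subsets of Fin n, so there are exactly (n choose k) of them. -/

import Mathlib

open Module

/-- The linear automorphism of `ℂⁿ` given by an element `t` of the torus `(ℂˣ)ⁿ`:
`v ↦ (i ↦ t i * v i)`. -/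
noncomputable def tMap {n : ℕ} (t : Fin n → ℂˣ) : (Fin n → ℂ) →ₗ[ℂ] (Fin n → ℂ) :=
  LinearMap.pi fun i => (t i : ℂ) • LinearMap.proj i

theorem cs_mem {n : ℕ} (I : Finset (Fin n)) (v : Fin n → ℂ) :
    v ∈ Submodule.span ℂ ((fun i => (Pi.single i 1 : Fin n → ℂ)) '' (I : Set (Fin n))) ↔
      ∀ i, i ∉ I → v i = 0 := by
  constructor
  · intro hv i hi
    induction hv using Submodule.span_induction with
    | mem x hx =>
      obtain ⟨j, hj, rfl⟩ := hx
      have hne : i ≠ j := by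
        rintro rfl
        exact hi hj
      simp [hne]
    | zero => rfl
    | add x y _ _ hx hy => simp [hx, hy]
    | smul a x _ hx => simp [hx]
  · intro h
    have hv : v = ∑ i, v i • (Pi.single i 1 : Fin n → ℂ) := by
      ext j
      simp [Finset.sum_apply, Pi.single_apply]
    rw [hv]
    refine Submodule.sum_mem _ fun i _ => ?_
    by_cases hi : i ∈ I
    · exact Submodule.smul_mem _ _ (Submodule.subset_span ⟨i, hi, rfl⟩)
    · simp [h i hi]

theorem cs_finrank {n : ℕ} (I : Finset (Fin n)) :
    finrank ℂ (Submodule.span ℂ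
      ((fun i => (Pi.single i 1 : Fin n → ℂ)) '' (I : Set (Fin n)))) = I.card := by
  have hli : LinearIndependent ℂ (fun i : Fin n => (Pi.single i 1 : Fin n → ℂ)) := by
    convert (Pi.basisFun ℂ (Fin n)).linearIndependent using 1
    ext i
    simp
  have h2 := hli.comp (fun i : I => (i : Fin n)) Subtype.val_injective
  have h3 := finrank_span_eq_card h2
  rw [Set.image_eq_range]
  simpa [Function.comp_def] using h3

theorem cs_fixed {n : ℕ} (I : Finset (Fin n)) (t : Fin n → ℂˣ) :
    Submodule.map (tMap t) (Submodule.span ℂ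
      ((fun i => (Pi.single i 1 : Fin n → ℂ)) '' (I : Set (Fin n)))) =
    Submodule.span ℂ ((fun i => (Pi.single i 1 : Fin n → ℂ)) '' (I : Set (Fin n))) := by
  ext v
  rw [Submodule.mem_map]
  constructor
  · rintro ⟨w, hw, rfl⟩
    rw [cs_mem] at hw ⊢
    intro i hi
    simp [tMap, hw i hi]
  · intro hv
    rw [cs_mem] at hv
    refine ⟨fun i => ((t i)⁻¹ : ℂˣ) * v i, ?_, ?_⟩
    · rw [cs_mem]
      intro i hi
      simp [hv i hi]
    · ext i
      simp [tMap]

theorem cs_of_fixed {n : ℕ} (L : Submodule ℂ (Fin n → ℂ))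
    (h : ∀ t : Fin n → ℂˣ, Submodule.map (tMap t) L = L) :
    ∃ I : Finset (Fin n),
      L = Submodule.span ℂ ((fun i => (Pi.single i 1 : Fin n → ℂ)) '' (I : Set (Fin n))) := by
  classical
  refine ⟨Finset.univ.filter fun i => (Pi.single i 1 : Fin n → ℂ) ∈ L, le_antisymm ?_ ?_⟩
  · intro v hv
    rw [cs_mem]
    intro i hi
    by_contra hne
    apply hi
    simp only [Finset.mem_filter, Finset.mem_univ, true_and]
    have h1 : tMap (Function.update 1 i (Units.mk0 (2 : ℂ) two_ne_zero)) v ∈ L := by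
      exact (h (Function.update 1 i (Units.mk0 (2 : ℂ) two_ne_zero))).le
        (Submodule.mem_map_of_mem hv)
    have h2 := L.smul_mem (v i)⁻¹ (L.sub_mem h1 hv)
    convert h2 using 1
    ext j
    by_cases hj : j = i
    · subst hj
      simp [tMap]
      field_simp
      ring
    · simp [tMap, hj]
  · rw [Submodule.span_le]
    rintro _ ⟨i, hi, rfl⟩
    simpa using hi

theorem cs_inj {n : ℕ} (I J : Finset (Fin n))
    (h : Submodule.span ℂ ((fun i => (Pi.single i 1 : Fin n → ℂ)) '' (I : Set (Fin n))) =
      Submodule.span ℂ ((fun i => (Pi.single i 1 : Fin n → ℂ)) '' (J : Set (Fin n)))) :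
    I = J := by
  have key : ∀ (K : Finset (Fin n)) (i : Fin n), i ∈ K ↔ (Pi.single i 1 : Fin n → ℂ) ∈
      Submodule.span ℂ ((fun i => (Pi.single i 1 : Fin n → ℂ)) '' (K : Set (Fin n))) := by
    intro K i
    refine ⟨fun hi => Submodule.subset_span ⟨i, hi, rfl⟩, fun hi => ?_⟩
    rw [cs_mem] at hi
    by_contra hc
    simpa using hi i hc
  ext i
  rw [key I, key J, h]

/-- A `k`-dimensional subspace of `ℂⁿ` is fixed by the canonical torus action iff it is a
coordinate subspace, spanned by the standard basis vectors indexed by a `k`-element subset of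
`Fin n`; consequently the torus-fixed points of `G_{n,k}` number exactly `n.choose k`. -/
theorem torus_fixed_subspaces_are_coordinate_subspaces (n k : ℕ) :
    (∀ L : Submodule ℂ (Fin n → ℂ), finrank ℂ L = k →
      ((∀ t : Fin n → ℂˣ, Submodule.map (tMap t) L = L) ↔
        ∃ I : Finset (Fin n), I.card = k ∧
          L = Submodule.span ℂ ((fun i => (Pi.single i 1 : Fin n → ℂ)) '' I))) ∧
    Nat.card {L : Submodule ℂ (Fin n → ℂ) //
        finrank ℂ L = k ∧ ∀ t : Fin n → ℂˣ, Submodule.map (tMap t) L = L} = n.choose k := by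
  refine ⟨fun L hL => ⟨fun h => ?_, ?_⟩, ?_⟩
  · obtain ⟨I, rfl⟩ := cs_of_fixed L h
    exact ⟨I, by rw [← hL, cs_finrank], rfl⟩
  · rintro ⟨I, -, rfl⟩ t
    exact cs_fixed I t
  · have hb : Function.Bijective (fun I : {I : Finset (Fin n) // I.card = k} =>
        (⟨Submodule.span ℂ ((fun i => (Pi.single i 1 : Fin n → ℂ)) '' (I.1 : Set (Fin n))),
          (cs_finrank I.1).trans I.2, cs_fixed I.1⟩ :
          {L : Submodule ℂ (Fin n → ℂ) //
            finrank ℂ L = k ∧ ∀ t : Fin n → ℂˣ, Submodule.map (tMap t) L = L})) := by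
      constructor
      · intro I J hIJ
        exact Subtype.ext (cs_inj _ _ (congrArg Subtype.val hIJ))
      · rintro ⟨L, hL, h⟩
        obtain ⟨I, rfl⟩ := cs_of_fixed L h
        exact ⟨⟨I, by rw [← hL, cs_finrank]⟩, rfl⟩
    rw [← Nat.card_eq_of_bijective _ hb]
    simp
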